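/- arXiv:1006.5620 — 2 statements merged into one kernel-verified Lean document; each statement's English description precedes it below -/
import Mathlib

section
/- Let A be an associative ℂ-algebra acting on a vector space W, with the induced derivation action of A (and hence of U(A)) on Sym^d(W). Let E_r ⊆ End(Sym^d(W)) be the span of images of elements of U(A) of degree at most r, and E the union of all E_r. Then E = E_d. -/
/-- The span of the images in `End(R)` of the monomials of `U(A)` of degree at most `r`,
where each `a ∈ A` acts by the derivation `D a` (the derivation extension of the action
of `A` on `W ⊂ R`). The empty product (degree `0`) is the identity, corresponding to
`1 ∈ U(A)`. -/
noncomputable def Efam {A R : Type*} [NonUnitalRing A] [Module ℂ A]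
    [CommRing R] [Algebra ℂ R] (D : A → Derivation ℂ R R) (r : ℕ) :
    Submodule ℂ (R →ₗ[ℂ] R) :=
  Submodule.span ℂ
    {T | ∃ s : ℕ, s ≤ r ∧ ∃ a : Fin s → A,
      T = (List.ofFn fun i => (D (a i)).toLinearMap).prod}

/-- The polarized operator attached to `a : Fin n → A`: on a product of elements of `W` it is the
sum, over all ways of applying the `a i` to pairwise distinct factors, of the results. -/
noncomputable def polarizedOp {A R : Type*} [Mul A] [CommRing R] [Algebra ℂ R]
    (D : A → Derivation ℂ R R) : (n : ℕ) → (Fin n → A) → (R →ₗ[ℂ] R)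
  | 0, _ => 1
  | n + 1, a => (D (a 0)).toLinearMap * polarizedOp D n (Fin.tail a) -
      ∑ i, polarizedOp D n (Function.update (Fin.tail a) i (a 0 * Fin.tail a i))

section

variable {A R : Type*} [CommRing R] [Algebra ℂ R]

theorem polarizedOp_succ_apply [Mul A] (D : A → Derivation ℂ R R) {n : ℕ} (a : Fin (n + 1) → A)
    (y : R) : polarizedOp D (n + 1) a y = D (a 0) (polarizedOp D n (Fin.tail a) y) -
      ∑ i, polarizedOp D n (Function.update (Fin.tail a) i (a 0 * Fin.tail a i)) y := by
  simp [polarizedOp, LinearMap.sum_apply]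

theorem polarizedOp_mul [Mul A] {W : Submodule ℂ R} {D : A → Derivation ℂ R R}
    (hmul : ∀ a b : A, ∀ x ∈ W, D (a * b) x = D a (D b x)) {x : R} (hx : x ∈ W) (n : ℕ)
    (a : Fin (n + 1) → A) (y : R) :
    polarizedOp D (n + 1) a (x * y) = x * polarizedOp D (n + 1) a y +
      ∑ i, D (a i) x * polarizedOp D n (Fin.removeNth i a) y := by
  induction n generalizing y with
  | zero => simp [polarizedOp, mul_comm]
  | succ n ih =>
    have hupdate (t : Fin (n + 1) → A) (v : A) (j : Fin (n + 1)) (k : Fin n) :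
        Fin.removeNth j (Function.update t (j.succAbove k) v) =
          Function.update (Fin.removeNth j t) k v :=
      Function.update_comp_eq_of_injective t Fin.succAbove_right_injective k v
    have htail (j : Fin (n + 1)) :
        Fin.tail (Fin.removeNth j.succ a) = Fin.removeNth j (Fin.tail a) := by
      funext k
      simp [Fin.tail, Fin.removeNth]
    have hzero (j : Fin (n + 1)) : Fin.removeNth j.succ a 0 = a 0 := by
      simp [Fin.removeNth]
    have hsum : ∑ i, ∑ j, D (Function.update (Fin.tail a) i (a 0 * Fin.tail a i) j) x *
          polarizedOp D n (Fin.removeNth j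
            (Function.update (Fin.tail a) i (a 0 * Fin.tail a i))) y =
        ∑ j, (D (a 0) (D (Fin.tail a j) x) * polarizedOp D n (Fin.removeNth j (Fin.tail a)) y +
          D (Fin.tail a j) x * (D (a 0) (polarizedOp D n (Fin.removeNth j (Fin.tail a)) y) -
            polarizedOp D (n + 1) (Fin.removeNth j.succ a) y)) := by
      rw [Finset.sum_comm]
      refine Finset.sum_congr rfl fun j _ => ?_
      rw [Fin.sum_univ_succAbove _ j, polarizedOp_succ_apply, htail, hzero, sub_sub_cancel,
        Finset.mul_sum]
      congr 1
      · simp [hmul _ _ x hx]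
      · refine Finset.sum_congr rfl fun k _ => ?_
        rw [hupdate, Function.update_of_ne (Fin.ne_succAbove j k)]
        rfl
    rw [polarizedOp_succ_apply, ih]
    simp_rw [ih]
    rw [Finset.sum_add_distrib, hsum, polarizedOp_succ_apply D a y,
      Fin.sum_univ_succ fun i => D (a i) x * polarizedOp D (n + 1) (Fin.removeNth i a) y]
    simp only [map_add, map_sum, Derivation.leibniz, smul_eq_mul, Finset.sum_add_distrib,
      mul_sub, Finset.sum_sub_distrib, Finset.mul_sum, Fin.removeNth_zero]
    simp only [Fin.tail, mul_comm]
    ring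

theorem polarizedOp_one [Mul A] (D : A → Derivation ℂ R R) (n : ℕ) (a : Fin (n + 1) → A) :
    polarizedOp D (n + 1) a 1 = 0 := by
  induction n with
  | zero => simp [polarizedOp]
  | succ n ih => simp [polarizedOp_succ_apply D a, ih]

theorem polarizedOp_eq_zero_of_lt [Mul A] {W : Submodule ℂ R} {D : A → Derivation ℂ R R}
    (hmul : ∀ a b : A, ∀ x ∈ W, D (a * b) x = D a (D b x)) {d n : ℕ} (hdn : d < n)
    (a : Fin n → A) {x : R} (hx : x ∈ W ^ d) : polarizedOp D n a x = 0 := by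
  induction d generalizing n x with
  | zero =>
    obtain ⟨n, rfl⟩ := Nat.exists_eq_add_one_of_ne_zero hdn.ne'
    rw [pow_zero] at hx
    obtain ⟨c, rfl⟩ := Submodule.mem_one.1 hx
    rw [Algebra.algebraMap_eq_smul_one, map_smul, polarizedOp_one, smul_zero]
  | succ d ih =>
    obtain ⟨n, rfl⟩ := Nat.exists_eq_add_one_of_ne_zero (Nat.ne_zero_of_lt hdn)
    rw [pow_succ'] at hx
    induction hx using Submodule.mul_induction_on' with
    | mem_mul_mem w hw y hy =>
      rw [polarizedOp_mul hmul hw, ih (by lia) a hy]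
      simp [ih (show d < n by lia) _ hy]
    | add y _ z _ hy hz => rw [map_add, hy, hz, add_zero]

theorem Efam_mono [NonUnitalRing A] [Module ℂ A] (D : A → Derivation ℂ R R) :
    Monotone (Efam D) := by
  intro r s hrs
  refine Submodule.span_mono ?_
  rintro T ⟨n, hn, a, rfl⟩
  exact ⟨n, hn.trans hrs, a, rfl⟩

theorem mul_mem_Efam_succ [NonUnitalRing A] [Module ℂ A] {D : A → Derivation ℂ R R} {r : ℕ}
    {T : R →ₗ[ℂ] R} (hT : T ∈ Efam D r) (b : A) :
    (D b).toLinearMap * T ∈ Efam D (r + 1) := by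
  induction hT using Submodule.span_induction with
  | mem T hT =>
    obtain ⟨n, hn, a, rfl⟩ := hT
    exact Submodule.subset_span ⟨n + 1, by lia, Fin.cons b a, by simp [List.ofFn_succ]⟩
  | zero => simp
  | add S T _ _ hS hT => rw [mul_add]; exact add_mem hS hT
  | smul c T _ hT => rw [mul_smul_comm]; exact Submodule.smul_mem _ c hT

theorem polarizedOp_mem_Efam [NonUnitalRing A] [Module ℂ A] (D : A → Derivation ℂ R R) (n : ℕ)
    (a : Fin n → A) : polarizedOp D n a ∈ Efam D n := by
  induction n with
  | zero => exact Submodule.subset_span ⟨0, le_rfl, a, by simp [polarizedOp]⟩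
  | succ n ih =>
    exact sub_mem (mul_mem_Efam_succ (ih _) _)
      (sum_mem fun i _ => Efam_mono D n.le_succ (ih _))

theorem Efam_le_span_polarizedOp [NonUnitalRing A] [Module ℂ A] (D : A → Derivation ℂ R R)
    (r : ℕ) : Efam D r ≤
      Submodule.span ℂ (Set.range fun p : Σ n, Fin n → A => polarizedOp D p.1 p.2) := by
  refine Submodule.span_le.2 ?_
  rintro _ ⟨s, -, a, rfl⟩
  induction s with
  | zero => exact Submodule.subset_span ⟨⟨0, a⟩, by simp [polarizedOp]⟩
  | succ s ih =>
    rw [List.ofFn_succ, List.prod_cons]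
    have hT := ih (Fin.tail a)
    simp only [Fin.tail, SetLike.mem_coe] at hT ⊢
    generalize (List.ofFn fun i : Fin s => (D (a i.succ)).toLinearMap).prod = T at hT ⊢
    induction hT using Submodule.span_induction with
    | mem T hT =>
      obtain ⟨⟨n, b⟩, rfl⟩ := hT
      have hb : (D (a 0)).toLinearMap * polarizedOp D n b =
          polarizedOp D (n + 1) (Fin.cons (a 0) b) +
            ∑ i, polarizedOp D n (Function.update b i (a 0 * b i)) := by
        simp [polarizedOp]
      simp only [hb]
      exact add_mem (Submodule.subset_span ⟨⟨n + 1, _⟩, rfl⟩)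
        (sum_mem fun i _ => Submodule.subset_span ⟨⟨n, _⟩, rfl⟩)
    | zero => simp
    | add S T _ _ hS hT => rw [mul_add]; exact add_mem hS hT
    | smul c T _ hT => rw [mul_smul_comm]; exact Submodule.smul_mem _ c hT

end


/-- Let `A` be an associative (not necessarily unital) `ℂ`-algebra acting on a subspace
`W` of a commutative `ℂ`-algebra `R` (playing the role of `Sym(W)`), via derivations
`D a` of `R`; the hypothesis `hmul` says that on `W` this is an associative-algebra
representation.  Let `E_r` be the span of images of elements of `U(A)` of degree at
most `r` acting on `Sym^d(W)` (modelled as `W ^ d ⊆ R`), and `E = ⋃ᵣ E_r`.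
Then `E = E_d`: every operator in some `E_r` agrees on `W ^ d` with one in `E_d`. -/
theorem efam_eq_degree_d {A R : Type*} [NonUnitalRing A] [Module ℂ A]
    [CommRing R] [Algebra ℂ R]
    (W : Submodule ℂ R) (D : A → Derivation ℂ R R)
    (hW : ∀ a : A, ∀ x ∈ W, D a x ∈ W)
    (hmul : ∀ a b : A, ∀ x ∈ W, D (a * b) x = D a (D b x))
    (d : ℕ) :
    ∀ r : ℕ, ∀ T ∈ Efam D r, ∃ T' ∈ Efam D d, ∀ x ∈ W ^ d, T x = T' x := by
  intro r T hT
  replace hT := Efam_le_span_polarizedOp D r hT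
  induction hT using Submodule.span_induction with
  | mem T hT =>
    obtain ⟨⟨n, a⟩, rfl⟩ := hT
    rcases le_or_gt n d with hn | hn
    · exact ⟨_, Efam_mono D hn (polarizedOp_mem_Efam D n a), fun _ _ => rfl⟩
    · exact ⟨0, zero_mem _, fun x hx => polarizedOp_eq_zero_of_lt hmul hn a hx⟩
  | zero => exact ⟨0, zero_mem _, fun _ _ => rfl⟩
  | add S T _ _ hS hT =>
    obtain ⟨S', hS', hSS'⟩ := hS
    obtain ⟨T', hT', hTT'⟩ := hT
    exact ⟨S' + T', add_mem hS' hT', fun x hx => by simp [hSS' x hx, hTT' x hx]⟩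
  | smul c T _ hT =>
    obtain ⟨T', hT', hTT'⟩ := hT
    exact ⟨c • T', Submodule.smul_mem _ c hT', fun x hx => by simp [hTT' x hx]⟩
end

section
/- With q_{a,b} = Σ_{i=1}^n x_{i,a} x_{i,b} as above and commuting indeterminates Q_{a,b} = Q_{b,a}, the kernel of the surjection ℂ[Q_{a,b}] → (Sym ⊕_{k≥0} V_k)^{O(n)} sending Q_{a,b} ↦ q_{a,b} is generated by the (n+1)×(n+1) determinants d_{I,J} = det(Q_{i_r, j_s})_{0 ≤ r,s ≤ n}, where I = (i_0 < ⋯ < i_n) and J = (j_0 < ⋯ < j_n) range over strictly increasing lists of nonnegative integers. -/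
open MvPolynomial

/-- Index type for the commuting indeterminates `Q_{a,b}` with `a ≤ b`
(so that `Q_{a,b} = Q_{b,a}` automatically). -/
abbrev PairLE : Type := {p : ℕ × ℕ // p.1 ≤ p.2}

/-- The indeterminate `Q_{a,b}` (symmetric in `a, b`). -/
noncomputable def Qv (a b : ℕ) : MvPolynomial PairLE ℂ :=
  X ⟨(min a b, max a b), min_le_max⟩

/-- The index of `Q_{a,b}`, the unordered pair `{a, b}`. -/
def unorderedPair (a b : ℕ) : PairLE := ⟨(min a b, max a b), min_le_max⟩

theorem unorderedPair_comm (a b : ℕ) : unorderedPair a b = unorderedPair b a := by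
  simp only [unorderedPair, min_comm, max_comm]

theorem unorderedPair_self (p : PairLE) : unorderedPair p.1.1 p.1.2 = p := by
  obtain ⟨⟨a, b⟩, h⟩ := p
  simp only at h
  simp [unorderedPair, h]

theorem unorderedPair_eq_iff {a b c d : ℕ} :
    unorderedPair a b = unorderedPair c d ↔ a = c ∧ b = d ∨ a = d ∧ b = c := by
  simp only [unorderedPair, Subtype.mk.injEq, Prod.mk.injEq]
  omega

/-- The substitution `Q_{a,b} ↦ ∑ i, x_{i,a} x_{i,b}`. -/
noncomputable def gramHom (n : ℕ) :
    MvPolynomial PairLE ℂ →ₐ[ℂ] MvPolynomial (Fin n × ℕ) ℂ :=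
  aeval (R := ℂ) (fun p : PairLE =>
    ∑ i : Fin n, (X (i, p.1.1) * X (i, p.1.2) : MvPolynomial (Fin n × ℕ) ℂ))

/-- The ideal generated by the `(n+1) × (n+1)` minors of the generic symmetric matrix. -/
noncomputable def minorIdeal (n : ℕ) : Ideal (MvPolynomial PairLE ℂ) :=
  Ideal.span {dd : MvPolynomial PairLE ℂ |
    ∃ I J : Fin (n + 1) → ℕ, StrictMono I ∧ StrictMono J ∧
      dd = Matrix.det (Matrix.of fun r s : Fin (n + 1) => Qv (I r) (J s))}

/-! ### The minors lie in the kernel -/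

theorem Matrix.det_mul_eq_zero_of_fin_succ {R : Type*} [CommRing R] {n : ℕ}
    (A : Matrix (Fin (n + 1)) (Fin n) R) (B : Matrix (Fin n) (Fin (n + 1)) R) :
    (A * B).det = 0 := by
  let A' : Matrix (Fin (n + 1)) (Fin (n + 1)) R := Matrix.of fun r => Fin.cons 0 (A r)
  let B' : Matrix (Fin (n + 1)) (Fin (n + 1)) R := Matrix.of (Fin.cons 0 B)
  have h : A * B = A' * B' := by
    ext r s
    simp only [A', B', Matrix.mul_apply, Matrix.of_apply, Fin.sum_univ_succ, Fin.cons_zero,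
      Fin.cons_succ, zero_mul, zero_add]
    rfl
  rw [h, Matrix.det_mul, Matrix.det_eq_zero_of_column_eq_zero (A := A') 0 (by simp [A']), zero_mul]

theorem gramHom_Qv (n a b : ℕ) : gramHom n (Qv a b) = ∑ i : Fin n, X (i, a) * X (i, b) := by
  simp only [gramHom, Qv, aeval_X]
  rcases le_total a b with h | h
  · simp [h]
  · simp [h, mul_comm]

theorem minorIdeal_le_ker (n : ℕ) : minorIdeal n ≤ RingHom.ker (gramHom n) := by
  rw [minorIdeal, Ideal.span_le]
  rintro _ ⟨I, J, -, -, rfl⟩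
  rw [SetLike.mem_coe, RingHom.mem_ker, AlgHom.map_det]
  convert Matrix.det_mul_eq_zero_of_fin_succ
    (Matrix.of fun r i => (X (i, I r) : MvPolynomial (Fin n × ℕ) ℂ))
    (Matrix.of fun i s => X (i, J s)) using 2
  ext1 r s
  simp [Matrix.mul_apply, gramHom_Qv]

/-! ### Straightening -/

/-- An exponent vector is standard if its support, viewed as a symmetric set of pairs, contains no
chain of `n + 1` pairs increasing strictly in both coordinates. -/
def IsStandard (n : ℕ) (A : PairLE →₀ ℕ) : Prop :=
  ∀ I J : Fin (n + 1) → ℕ, StrictMono I → StrictMono J →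
    ∃ r, unorderedPair (I r) (J r) ∉ A.support

/-- The weight giving `Q_{a,b}` degree `a * b`. -/
noncomputable def mulWeight : (PairLE →₀ ℕ) →+ ℕ := Finsupp.weight fun p : PairLE => p.1.1 * p.1.2

theorem mulWeight_single (a b : ℕ) :
    mulWeight (Finsupp.single (unorderedPair a b) 1) = a * b := by
  simp [mulWeight, Finsupp.weight_single, unorderedPair, min_mul_max]

theorem prod_Qv {κ : Type*} [Fintype κ] (I J : κ → ℕ) :
    ∏ r, Qv (I r) (J r) = monomial (∑ r, Finsupp.single (unorderedPair (I r) (J r)) 1) 1 := by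
  rw [monomial_sum_one]
  rfl

theorem sum_comp_perm_mul_lt {m : ℕ} {I J : Fin m → ℕ} (hI : StrictMono I) (hJ : StrictMono J)
    {σ : Equiv.Perm (Fin m)} (hσ : σ ≠ 1) : ∑ r, I (σ r) * J r < ∑ r, I r * J r := by
  have hm : Monovary I J := hI.monotone.monovary hJ.monotone
  rw [hm.sum_comp_perm_mul_lt_sum_mul_iff]
  intro h
  apply hσ
  have hs : StrictMono σ := by
    refine Monotone.strictMono_of_injective ?_ σ.injective
    refine monotone_iff_forall_lt.2 fun i j hij => ?_
    exact hI.le_iff_le.1 (h (hJ hij))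
  have := (hs.range_inj strictMono_id).1 (by simp [σ.surjective.range_eq])
  ext r
  simp [this]

theorem injective_unorderedPair {m : ℕ} {I J : Fin m → ℕ} (hI : StrictMono I)
    (hJ : StrictMono J) : Function.Injective fun r => unorderedPair (I r) (J r) := by
  intro r s h
  rcases unorderedPair_eq_iff.1 h with ⟨h, -⟩ | ⟨h₁, h₂⟩
  · exact hI.injective h
  · rcases lt_trichotomy r s with h | h | h
    · have := hI h
      have := hJ h
      omega
    · exact h
    · have := hI h
      have := hJ h
      omega

theorem sum_single_le {κ α : Type*} [Fintype κ] {e : κ → α} (he : Function.Injective e)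
    {A : α →₀ ℕ} (hA : ∀ k, e k ∈ A.support) : ∑ k, Finsupp.single (e k) 1 ≤ A := by
  classical
  intro p
  rw [Finsupp.finsetSum_apply]
  by_cases hp : ∃ k, e k = p
  · obtain ⟨k, rfl⟩ := hp
    rw [Finset.sum_eq_single k (fun l _ hl => Finsupp.single_eq_of_ne (he.ne hl).symm) (by simp)]
    have := Finsupp.mem_support_iff.1 (hA k)
    simp
    omega
  · push Not at hp
    rw [Finset.sum_eq_zero fun k _ => Finsupp.single_eq_of_ne (hp k).symm]
    exact Nat.zero_le _

theorem monomial_mem_minorIdeal_sup (n : ℕ) (A : PairLE →₀ ℕ) :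
    (monomial A 1 : MvPolynomial PairLE ℂ) ∈
      (minorIdeal n).restrictScalars ℂ ⊔ restrictSupport ℂ {B | IsStandard n B} := by
  induction hw : mulWeight A using Nat.strong_induction_on generalizing A with
  | _ w ih =>
  by_cases hA : IsStandard n A
  · exact Submodule.mem_sup_right ((monomial_mem_restrictSupport ℂ).2 (Or.inl hA))
  simp only [IsStandard] at hA
  push Not at hA
  obtain ⟨I, J, hI, hJ, h⟩ := hA
  let E (σ : Equiv.Perm (Fin (n + 1))) : PairLE →₀ ℕ :=
    ∑ r, Finsupp.single (unorderedPair (I (σ r)) (J r)) 1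
  have hE (σ) : mulWeight (E σ) = ∑ r, I (σ r) * J r := by
    simp [E, map_sum, mulWeight_single]
  obtain ⟨B, hB⟩ := exists_add_of_le (sum_single_le (injective_unorderedPair hI hJ) h)
  have hAB : A = B + E 1 := by rw [hB, add_comm]; rfl
  have hdet : monomial B 1 * Matrix.det (Matrix.of fun r s => Qv (I r) (J s)) =
      monomial A 1 + ∑ σ ∈ Finset.univ.erase 1,
        (Equiv.Perm.sign σ : ℤ) • (monomial (B + E σ) 1 : MvPolynomial PairLE ℂ) := by
    rw [Matrix.det_apply, Finset.mul_sum, ← Finset.add_sum_erase _ _ (Finset.mem_univ 1)]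
    congr 1
    · simp only [Equiv.Perm.sign_one, one_smul, Matrix.of_apply]
      rw [prod_Qv (fun r => I ((1 : Equiv.Perm (Fin (n + 1))) r)), monomial_mul, one_mul, hAB]
    · refine Finset.sum_congr rfl fun σ _ => ?_
      simp only [Matrix.of_apply]
      rw [prod_Qv (fun r => I (σ r)), mul_smul_comm, monomial_mul, one_mul]
      rfl
  rw [← sub_eq_iff_eq_add] at hdet
  rw [← hdet]
  refine Submodule.sub_mem _ (Submodule.mem_sup_left ?_) (Submodule.sum_mem _ fun σ hσ => ?_)
  · exact Ideal.mul_mem_left _ _ (Ideal.subset_span ⟨I, J, hI, hJ, rfl⟩)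
  · refine zsmul_mem (ih _ ?_ _ rfl) _
    rw [← hw, hAB, map_add, map_add, hE, hE]
    exact Nat.add_lt_add_left (sum_comp_perm_mul_lt hI hJ (Finset.ne_of_mem_erase hσ)) _

theorem exists_standard_sub_mem_minorIdeal (n : ℕ) (f : MvPolynomial PairLE ℂ) :
    ∃ h : MvPolynomial PairLE ℂ, (∀ A ∈ h.support, IsStandard n A) ∧ f - h ∈ minorIdeal n := by
  have hf : f ∈ (minorIdeal n).restrictScalars ℂ ⊔ restrictSupport ℂ {B | IsStandard n B} := by
    rw [f.as_sum]
    refine Submodule.sum_mem _ fun A _ => ?_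
    rw [← mul_one (coeff A f), ← smul_eq_mul, ← smul_monomial]
    exact Submodule.smul_mem _ _ (monomial_mem_minorIdeal_sup n A)
  obtain ⟨g, hg, h, hh, rfl⟩ := Submodule.mem_sup.1 hf
  exact ⟨h, fun A hA => (mem_restrictSupport_iff ℂ).1 hh hA, by simpa using hg⟩

/-! ### Colouring a standard monomial by antichains -/

/-- There is a chain of `k + 1` pairs in the support of `A` starting at `(a, b)`. -/
def HasChainFrom (A : PairLE →₀ ℕ) (a b k : ℕ) : Prop :=
  ∃ I J : Fin (k + 1) → ℕ, StrictMono I ∧ StrictMono J ∧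
    (∀ r, unorderedPair (I r) (J r) ∈ A.support) ∧ I 0 = a ∧ J 0 = b

theorem HasChainFrom.swap {A : PairLE →₀ ℕ} {a b k : ℕ} :
    HasChainFrom A a b k → HasChainFrom A b a k := by
  rintro ⟨I, J, hI, hJ, h, ha, hb⟩
  exact ⟨J, I, hJ, hI, fun r => unorderedPair_comm (I r) (J r) ▸ h r, hb, ha⟩

theorem hasChainFrom_zero {A : PairLE →₀ ℕ} {a b : ℕ} (h : unorderedPair a b ∈ A.support) :
    HasChainFrom A a b 0 :=
  ⟨fun _ => a, fun _ => b, Subsingleton.strictMono (α := Fin 1) _,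
    Subsingleton.strictMono (α := Fin 1) _, fun _ => h, rfl, rfl⟩

theorem HasChainFrom.cons {A : PairLE →₀ ℕ} {a b a' b' k : ℕ} (hc : HasChainFrom A a' b' k)
    (h : unorderedPair a b ∈ A.support) (ha : a < a') (hb : b < b') :
    HasChainFrom A a b (k + 1) := by
  obtain ⟨I, J, hI, hJ, hIJ, rfl, rfl⟩ := hc
  refine ⟨Matrix.vecCons a I, Matrix.vecCons b J, strictMono_vecCons.2 ⟨ha, hI⟩,
    strictMono_vecCons.2 ⟨hb, hJ⟩, fun r => ?_, rfl, rfl⟩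
  cases r using Fin.cases with
  | zero => simpa using h
  | succ r => simpa using hIJ r

theorem IsStandard.not_hasChainFrom {n : ℕ} {A : PairLE →₀ ℕ} (hA : IsStandard n A) (a b : ℕ) :
    ¬ HasChainFrom A a b n := by
  rintro ⟨I, J, hI, hJ, h, -, -⟩
  obtain ⟨r, hr⟩ := hA I J hI hJ
  exact hr (h r)

open Classical in
/-- The largest `k ≤ n` such that a chain of `k + 1` pairs in the support of `A` starts at
`(a, b)`. -/
noncomputable def chainHeight (n : ℕ) (A : PairLE →₀ ℕ) (a b : ℕ) : ℕ :=
  Nat.findGreatest (HasChainFrom A a b) n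

theorem chainHeight_comm (n : ℕ) (A : PairLE →₀ ℕ) (a b : ℕ) :
    chainHeight n A a b = chainHeight n A b a := by
  unfold chainHeight
  congr 1
  exact funext fun k => propext ⟨HasChainFrom.swap, HasChainFrom.swap⟩

theorem hasChainFrom_chainHeight (n : ℕ) {A : PairLE →₀ ℕ} {a b : ℕ}
    (h : unorderedPair a b ∈ A.support) : HasChainFrom A a b (chainHeight n A a b) := by
  classical
  exact Nat.findGreatest_spec (Nat.zero_le n) (hasChainFrom_zero h)

theorem IsStandard.chainHeight_lt {n : ℕ} {A : PairLE →₀ ℕ} (hA : IsStandard n A) {a b : ℕ}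
    (h : unorderedPair a b ∈ A.support) : chainHeight n A a b < n := by
  classical
  refine lt_of_le_of_ne (Nat.findGreatest_le n) fun he => hA.not_hasChainFrom a b ?_
  have := hasChainFrom_chainHeight n h
  rwa [he] at this

theorem IsStandard.chainHeight_lt_chainHeight {n : ℕ} {A : PairLE →₀ ℕ} (hA : IsStandard n A)
    {a b a' b' : ℕ} (h : unorderedPair a b ∈ A.support) (h' : unorderedPair a' b' ∈ A.support)
    (ha : a < a') (hb : b < b') : chainHeight n A a' b' < chainHeight n A a b := by
  classical
  exact Nat.le_findGreatest (hA.chainHeight_lt h')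
    ((hasChainFrom_chainHeight n h').cons h ha hb)

theorem IsStandard.exists_antichain_coloring {n : ℕ} {κ : Type*} {A : PairLE →₀ ℕ}
    (hA : IsStandard n A) (e : κ → PairLE) (he : ∀ k, e k ∈ A.support) :
    ∃ c : κ → Fin n, ∀ k l, c k = c l →
      ¬ ((e k).1.1 < (e l).1.1 ∧ (e k).1.2 < (e l).1.2) ∧
      ¬ ((e k).1.1 < (e l).1.2 ∧ (e k).1.2 < (e l).1.1) := by
  have hs (k) : unorderedPair (e k).1.1 (e k).1.2 ∈ A.support := by
    rw [unorderedPair_self]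
    exact he k
  refine ⟨fun k => ⟨_, hA.chainHeight_lt (hs k)⟩, fun k l h => ?_⟩
  rw [Fin.mk.injEq] at h
  constructor
  · rintro ⟨h₁, h₂⟩
    exact (hA.chainHeight_lt_chainHeight (hs k) (hs l) h₁ h₂).ne' h
  · rintro ⟨h₁, h₂⟩
    refine (hA.chainHeight_lt_chainHeight (hs k) (unorderedPair_comm _ _ ▸ hs l) h₁ h₂).ne' ?_
    rw [h, chainHeight_comm]

/-! ### The dominance order on exponent vectors -/

/-- The indicator function of `a < s`. -/
def indLT (s a : ℕ) : ℤ := if a < s then 1 else 0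

/-- The number of orderings of the pair `p` lying in the quadrant `[0, s) × [0, t)`. -/
def quadrantCount (s t : ℕ) (p : PairLE) : ℤ :=
  indLT s p.1.1 * indLT t p.1.2 + indLT s p.1.2 * indLT t p.1.1

/-- The function whose sum over the two ends of a pair bounds `quadrantCount` from below. -/
def endCount (s t a : ℕ) : ℤ := indLT s a + indLT t a - 1

theorem quadrantCount_nonneg (s t : ℕ) (p : PairLE) : 0 ≤ quadrantCount s t p := by
  simp only [quadrantCount, indLT]
  split_ifs <;> simp

theorem endCount_add_le_quadrantCount (s t : ℕ) (p : PairLE) :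
    endCount s t p.1.1 + endCount s t p.1.2 ≤ quadrantCount s t p := by
  simp only [quadrantCount, endCount, indLT]
  split_ifs <;> simp

theorem quadrantCount_eq_endCount_add {s t : ℕ} {p : PairLE} (h₁ : p.1.1 < s ∨ p.1.2 < t)
    (h₂ : p.1.2 < s ∨ p.1.1 < t) :
    quadrantCount s t p = endCount s t p.1.1 + endCount s t p.1.2 := by
  simp only [quadrantCount, endCount, indLT]
  split_ifs <;> simp <;> omega

/-- The number of entries of the symmetric matrix `A` in the quadrant `[0, s) × [0, t)`, with
diagonal entries counted twice. -/
noncomputable def quadrantSum (A : PairLE →₀ ℕ) (st : ℕ × ℕ) : ℤ :=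
  Finsupp.weight (quadrantCount st.1 st.2) A

theorem quadrantSum_sum_single {κ : Type*} [Fintype κ] (e : κ → PairLE) (st : ℕ × ℕ) :
    quadrantSum (∑ k, Finsupp.single (e k) 1) st = ∑ k, quadrantCount st.1 st.2 (e k) := by
  simp [quadrantSum, map_sum, Finsupp.weight_single]

theorem indLT_succ_sub (s a : ℕ) : indLT (s + 1) a - indLT s a = if a = s then 1 else 0 := by
  simp only [indLT]
  split_ifs <;> omega

theorem quadrantCount_alternating_sum (q p : PairLE) :
    quadrantCount (q.1.1 + 1) (q.1.2 + 1) p - quadrantCount q.1.1 (q.1.2 + 1) p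
      - quadrantCount (q.1.1 + 1) q.1.2 p + quadrantCount q.1.1 q.1.2 p =
    if p = q then (if q.1.1 = q.1.2 then 2 else 1) else 0 := by
  trans (indLT (q.1.1 + 1) p.1.1 - indLT q.1.1 p.1.1) * (indLT (q.1.2 + 1) p.1.2 - indLT q.1.2 p.1.2)
    + (indLT (q.1.1 + 1) p.1.2 - indLT q.1.1 p.1.2) * (indLT (q.1.2 + 1) p.1.1 - indLT q.1.2 p.1.1)
  · simp only [quadrantCount]
    ring
  · simp only [indLT_succ_sub]
    obtain ⟨⟨a, b⟩, hp⟩ := p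
    obtain ⟨⟨c, d⟩, hq⟩ := q
    simp only [Subtype.mk.injEq, Prod.mk.injEq] at *
    split_ifs <;> omega

theorem quadrantSum_alternating_sum (A : PairLE →₀ ℕ) (q : PairLE) :
    quadrantSum A (q.1.1 + 1, q.1.2 + 1) - quadrantSum A (q.1.1, q.1.2 + 1)
      - quadrantSum A (q.1.1 + 1, q.1.2) + quadrantSum A (q.1.1, q.1.2) =
    A q * (if q.1.1 = q.1.2 then 2 else 1) := by
  classical
  simp only [quadrantSum, Finsupp.weight_apply, Finsupp.sum]
  rw [← Finset.sum_sub_distrib, ← Finset.sum_sub_distrib, ← Finset.sum_add_distrib]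
  simp only [← smul_sub, ← smul_add, quadrantCount_alternating_sum]
  rw [Finset.sum_eq_single q (fun p _ hp => by simp [hp]) (fun hq => by simp_all)]
  simp

theorem quadrantSum_injective : Function.Injective quadrantSum := by
  intro A B h
  ext q
  have hA := quadrantSum_alternating_sum A q
  rw [h, quadrantSum_alternating_sum B q] at hA
  split_ifs at hA <;> omega

/-! ### Leading terms -/

/-- The exponent of `x_{i,a} x_{i,b}`, where `p = {a, b}`. -/
noncomputable def coloredDegree {n : ℕ} (i : Fin n) (p : PairLE) : Fin n × ℕ →₀ ℕ :=
  Finsupp.single (i, p.1.1) 1 + Finsupp.single (i, p.1.2) 1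

theorem sum_filter_endCount {n : ℕ} {κ : Type*} [Fintype κ] (e : κ → PairLE) (c : κ → Fin n)
    (s t : ℕ) (i : Fin n) :
    ∑ k with c k = i, (endCount s t (e k).1.1 + endCount s t (e k).1.2) =
      Finsupp.weight (fun x : Fin n × ℕ => if x.1 = i then endCount s t x.2 else 0)
        (∑ k, coloredDegree (c k) (e k)) := by
  rw [map_sum, Finset.sum_filter]
  refine Finset.sum_congr rfl fun k _ => ?_
  simp only [coloredDegree, map_add, Finsupp.weight_single, one_smul]
  split_ifs <;> simp

theorem quadrantSum_le_of_antichain_coloring {n : ℕ} {κ κ' : Type*} [Fintype κ] [Fintype κ']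
    {e : κ → PairLE} {c : κ → Fin n} {e' : κ' → PairLE} {c' : κ' → Fin n}
    (hc : ∀ k l, c k = c l →
      ¬ ((e k).1.1 < (e l).1.1 ∧ (e k).1.2 < (e l).1.2) ∧
      ¬ ((e k).1.1 < (e l).1.2 ∧ (e k).1.2 < (e l).1.1))
    (h : ∑ k, coloredDegree (c' k) (e' k) = ∑ k, coloredDegree (c k) (e k)) :
    quadrantSum (∑ k, Finsupp.single (e k) 1) ≤ quadrantSum (∑ k, Finsupp.single (e' k) 1) := by
  rintro ⟨s, t⟩
  rw [quadrantSum_sum_single, quadrantSum_sum_single, ← Finset.sum_fiberwise _ c,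
    ← Finset.sum_fiberwise _ c']
  refine Finset.sum_le_sum fun i _ => ?_
  by_cases hi : ∃ k, c k = i ∧
      ((e k).1.1 < s ∧ (e k).1.2 < t ∨ (e k).1.2 < s ∧ (e k).1.1 < t)
  · obtain ⟨k, hk, hst⟩ := hi
    calc ∑ l with c l = i, quadrantCount s t (e l)
        = ∑ l with c l = i, (endCount s t (e l).1.1 + endCount s t (e l).1.2) := by
          refine Finset.sum_congr rfl fun l hl => ?_
          have := hc k l (hk.trans (Finset.mem_filter.1 hl).2.symm)
          apply quadrantCount_eq_endCount_add <;> omega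
      _ = ∑ l with c' l = i, (endCount s t (e' l).1.1 + endCount s t (e' l).1.2) := by
          rw [sum_filter_endCount, sum_filter_endCount, h]
      _ ≤ _ := Finset.sum_le_sum fun l _ => endCount_add_le_quadrantCount s t (e' l)
  · push Not at hi
    rw [Finset.sum_eq_zero]
    · exact Finset.sum_nonneg fun l _ => quadrantCount_nonneg s t (e' l)
    · intro l hl
      have := hi l (Finset.mem_filter.1 hl).2
      simp only [quadrantCount, indLT]
      split_ifs <;> omega

open Classical in
theorem coeff_gramHom_monomial {n : ℕ} {κ : Type*} [Fintype κ] (e : κ → PairLE)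
    (D : Fin n × ℕ →₀ ℕ) :
    coeff D (gramHom n (monomial (∑ k, Finsupp.single (e k) 1) 1)) =
      (Finset.card {c : κ → Fin n | ∑ k, coloredDegree (c k) (e k) = D} : ℂ) := by
  have h : gramHom n (monomial (∑ k, Finsupp.single (e k) 1) 1) =
      ∑ c : κ → Fin n, monomial (∑ k, coloredDegree (c k) (e k)) 1 := by
    rw [monomial_sum_one, map_prod]
    trans ∏ k, ∑ i : Fin n, (monomial (coloredDegree i (e k)) 1 : MvPolynomial (Fin n × ℕ) ℂ)
    · refine Finset.prod_congr rfl fun k _ => ?_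
      change gramHom n (X (e k)) = _
      rw [gramHom, aeval_X]
      simp [X, coloredDegree, monomial_mul]
    · rw [Finset.prod_univ_sum, Fintype.piFinset_univ]
      exact Finset.sum_congr rfl fun c _ => (monomial_sum_one _ _).symm
  rw [h, coeff_sum]
  simp [coeff_monomial]

theorem exists_eq_sum_single {α : Type} (A : α →₀ ℕ) :
    ∃ (κ : Type) (_ : Fintype κ) (e : κ → α), A = ∑ k, Finsupp.single (e k) 1 := by
  induction A using Finsupp.induction_linear with
  | zero => exact ⟨Empty, inferInstance, Empty.elim, by simp⟩
  | add A B hA hB =>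
    obtain ⟨κ, _, e, rfl⟩ := hA
    obtain ⟨κ', _, e', rfl⟩ := hB
    exact ⟨κ ⊕ κ', inferInstance, Sum.elim e e', by simp⟩
  | single p d => exact ⟨Fin d, inferInstance, fun _ => p, by simp⟩

theorem IsStandard.exists_leading_coeff {n : ℕ} {A : PairLE →₀ ℕ} (hA : IsStandard n A) :
    ∃ D : Fin n × ℕ →₀ ℕ, coeff D (gramHom n (monomial A 1)) ≠ 0 ∧
      ∀ B, coeff D (gramHom n (monomial B 1)) ≠ 0 → quadrantSum A ≤ quadrantSum B := by
  classical
  obtain ⟨κ, _, e, rfl⟩ := exists_eq_sum_single A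
  obtain ⟨c, hc⟩ := hA.exists_antichain_coloring e fun k => by
    rw [Finsupp.mem_support_iff, Finsupp.finsetSum_apply]
    refine (Finset.sum_pos' (fun _ _ => Nat.zero_le _) ⟨k, Finset.mem_univ k, ?_⟩).ne'
    simp
  refine ⟨∑ k, coloredDegree (c k) (e k), ?_, fun B hB => ?_⟩
  · rw [coeff_gramHom_monomial, Nat.cast_ne_zero, Finset.card_ne_zero]
    exact ⟨c, by simp⟩
  · obtain ⟨κ', _, e', rfl⟩ := exists_eq_sum_single B
    rw [coeff_gramHom_monomial, Nat.cast_ne_zero, Finset.card_ne_zero] at hB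
    obtain ⟨c', hc'⟩ := hB
    exact quadrantSum_le_of_antichain_coloring hc (Finset.mem_filter.1 hc').2

theorem eq_zero_of_standard_of_mem_ker {n : ℕ} {h : MvPolynomial PairLE ℂ}
    (hs : ∀ A ∈ h.support, IsStandard n A) (hk : gramHom n h = 0) : h = 0 := by
  by_contra h0
  obtain ⟨A, hA⟩ := h.support.exists_maximalFor quadrantSum (support_nonempty.2 h0)
  obtain ⟨D, hD, hmin⟩ := (hs A hA.1).exists_leading_coeff
  have hsum : coeff D (gramHom n h) = coeff A h * coeff D (gramHom n (monomial A 1)) := by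
    conv_lhs => rw [h.as_sum]
    have hmon (B) : monomial B (coeff B h) = coeff B h • (monomial B 1 : MvPolynomial PairLE ℂ) := by
      rw [smul_monomial, smul_eq_mul, mul_one]
    rw [map_sum, coeff_sum, Finset.sum_eq_single A]
    · rw [hmon, map_smul, coeff_smul, smul_eq_mul]
    · intro B hB hBA
      rw [hmon, map_smul, coeff_smul, smul_eq_mul]
      by_contra hne
      have hle := hmin B (right_ne_zero_of_mul hne)
      exact hBA (quadrantSum_injective ((hA.2 hB hle).antisymm hle))
    · exact fun h => absurd hA.1 h
  rw [hk, coeff_zero] at hsum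
  exact mul_ne_zero (mem_support_iff.1 hA.1) hD hsum.symm

theorem ker_gramHom (n : ℕ) : RingHom.ker (gramHom n) = minorIdeal n := by
  refine le_antisymm (fun f hf => ?_) (minorIdeal_le_ker n)
  obtain ⟨h, hs, hfh⟩ := exists_standard_sub_mem_minorIdeal n f
  have hk : gramHom n h = 0 := by
    have := minorIdeal_le_ker n hfh
    rw [RingHom.mem_ker, map_sub, RingHom.mem_ker.1 hf, zero_sub, neg_eq_zero] at this
    exact this
  rwa [eq_zero_of_standard_of_mem_ker hs hk, sub_zero] at hfh

/-- Weyl's second fundamental theorem of invariant theory for the standard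
representation of `O(n)`: the kernel of the map `ℂ[Q_{a,b}] → Sym ⊕_{k≥0} V_k`
sending `Q_{a,b} ↦ q_{a,b} = Σ_i x_{i,a} x_{i,b}` (whose image is the invariant ring)
is generated by the `(n+1) × (n+1)` determinants `d_{I,J} = det (Q_{i_r, j_s})`
where `I` and `J` range over strictly increasing lists of `n+1` nonnegative
integers. -/
theorem weyl_sft_orthogonal (n : ℕ) :
    RingHom.ker
        (aeval (R := ℂ)
          (fun p : PairLE =>
            ∑ i : Fin n, (X (i, p.1.1) * X (i, p.1.2) : MvPolynomial (Fin n × ℕ) ℂ))) =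
      Ideal.span
        {dd : MvPolynomial PairLE ℂ |
          ∃ I J : Fin (n + 1) → ℕ, StrictMono I ∧ StrictMono J ∧
            dd = Matrix.det (Matrix.of fun r s : Fin (n + 1) => Qv (I r) (J s))} := by
  exact ker_gramHom n
end
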